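/- arXiv:math/0608673 — 2 statements merged into one kernel-verified Lean document; each statement's English description precedes it below -/
import Mathlib

section
/- For V = ℚ², the kernel of C₁₃ : Hom(V, V^{⊗3}) → V^{⊗2} equals the linear span of {[D₁,D₂] : D₁,D₂ ∈ Hom(V,V^{⊗2})}; consequently C₁₃ induces a linear isomorphism Hom(V, V^{⊗3}) / span{[D₁,D₂] : D₁,D₂ ∈ Hom(V,V^{⊗2})} ≅ V^{⊗2}. -/
set_option maxSynthPendingDepth 3

open scoped TensorProduct

/-- `V = ℚ²` -/
abbrev V2 := Fin 2 → ℚ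

/-- `V^{⊗2}` -/
abbrev TT2 := V2 ⊗[ℚ] V2
/-- `V^{⊗3}` (with the left-associated grouping) -/
abbrev TT3 := (V2 ⊗[ℚ] V2) ⊗[ℚ] V2

/-- The unique extension of a linear map `D : V → V⊗V` to a derivation of the tensor
algebra, restricted to a map `V^{⊗2} → V^{⊗3}`; on decomposables it is
`u₁ ⊗ u₂ ↦ D(u₁) ⊗ u₂ + u₁ ⊗ D(u₂)`. -/
noncomputable def ext1 (D : V2 →ₗ[ℚ] TT2) : TT2 →ₗ[ℚ] TT3 :=
  TensorProduct.map D LinearMap.id +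
    (TensorProduct.assoc ℚ V2 V2 V2).symm.toLinearMap ∘ₗ TensorProduct.map LinearMap.id D

/-- the bracket `[D₁, D₂]`, i.e. the restriction to `V` of `D̃₁ ∘ D̃₂ - D̃₂ ∘ D̃₁`. -/
noncomputable def brkt (D₁ D₂ : V2 →ₗ[ℚ] TT2) : V2 →ₗ[ℚ] TT3 :=
  ext1 D₁ ∘ₗ D₂ - ext1 D₂ ∘ₗ D₁

/-- The rank-one map `x ↦ f x • m`. -/
noncomputable abbrev rankOne {M : Type*} [AddCommGroup M] [Module ℚ M]
    (f : Module.Dual ℚ V2) (m : M) : V2 →ₗ[ℚ] M :=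
  dualTensorHom ℚ V2 M (f ⊗ₜ m)

lemma rankOne_apply {M : Type*} [AddCommGroup M] [Module ℚ M]
    (f : Module.Dual ℚ V2) (m : M) (x : V2) : rankOne f m x = f x • m :=
  dualTensorHom_apply f x m

lemma ext1_tmul (D : V2 →ₗ[ℚ] TT2) (u v : V2) :
    ext1 D (u ⊗ₜ v) = D u ⊗ₜ v + (TensorProduct.assoc ℚ V2 V2 V2).symm (u ⊗ₜ D v) := by
  simp [ext1]

lemma ext1_add (D D' : V2 →ₗ[ℚ] TT2) : ext1 (D + D') = ext1 D + ext1 D' := by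
  refine TensorProduct.ext' fun u v => ?_
  simp only [LinearMap.add_apply, ext1_tmul, TensorProduct.add_tmul, TensorProduct.tmul_add,
    map_add]
  abel

lemma brkt_add_left (D₁ D₁' D₂ : V2 →ₗ[ℚ] TT2) :
    brkt (D₁ + D₁') D₂ = brkt D₁ D₂ + brkt D₁' D₂ := by
  simp only [brkt, ext1_add, LinearMap.add_comp, LinearMap.comp_add]
  abel

lemma brkt_swap (D₁ D₂ : V2 →ₗ[ℚ] TT2) : brkt D₁ D₂ = -brkt D₂ D₁ := by
  simp [brkt]

lemma brkt_rankOne (f g : Module.Dual ℚ V2) (a b c d : V2) :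
    brkt (rankOne f (a ⊗ₜ b)) (rankOne g (c ⊗ₜ d)) =
      f c • rankOne g ((a ⊗ₜ[ℚ] b) ⊗ₜ[ℚ] d) + f d • rankOne g ((c ⊗ₜ[ℚ] a) ⊗ₜ[ℚ] b)
        - g a • rankOne f ((c ⊗ₜ[ℚ] d) ⊗ₜ[ℚ] b) - g b • rankOne f ((a ⊗ₜ[ℚ] c) ⊗ₜ[ℚ] d) := by
  refine LinearMap.ext fun x => ?_
  simp only [brkt, LinearMap.sub_apply, LinearMap.add_apply, LinearMap.smul_apply,
    LinearMap.comp_apply, rankOne_apply, map_smul, ext1_tmul, TensorProduct.tmul_smul,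
    ← TensorProduct.smul_tmul', TensorProduct.assoc_symm_tmul]
  module

lemma rankOne_tmul_induction {p : (V2 →ₗ[ℚ] TT2) → Prop}
    (h : ∀ f a b, p (rankOne f (a ⊗ₜ b))) (hadd : ∀ D D', p D → p D' → p (D + D'))
    (D : V2 →ₗ[ℚ] TT2) : p D := by
  have h_zero : p 0 := by simpa [rankOne] using h 0 0 0
  obtain ⟨t, rfl⟩ := (dualTensorHomEquiv ℚ V2 TT2).surjective D
  change p (dualTensorHom ℚ V2 TT2 t)
  induction t using TensorProduct.induction_on with
  | zero => simpa using h_zero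
  | add x y hx hy => simpa using hadd _ _ hx hy
  | tmul f m =>
    induction m using TensorProduct.induction_on with
    | zero => simpa using h_zero
    | add x y hx hy => simpa [TensorProduct.tmul_add] using hadd _ _ hx hy
    | tmul a b => exact h f a b

/-- The contraction `f ⊗ u₁ ⊗ u₂ ⊗ u₃ ↦ f u₂ • u₁ ⊗ u₃`. -/
noncomputable def contract13 : (V2 →ₗ[ℚ] TT3) →ₗ[ℚ] TT2 :=
  ∑ i : Fin 2, TensorProduct.map
    ((TensorProduct.rid ℚ V2).toLinearMap ∘ₗ
      TensorProduct.map LinearMap.id (LinearMap.proj i : V2 →ₗ[ℚ] ℚ)) LinearMap.id ∘ₗ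
    LinearMap.applyₗ (Pi.single i 1)

lemma contract13_rankOne (f : Module.Dual ℚ V2) (u₁ u₂ u₃ : V2) :
    contract13 (rankOne f ((u₁ ⊗ₜ u₂) ⊗ₜ u₃)) = f u₂ • (u₁ ⊗ₜ u₃) := by
  have hf : f u₂ = u₂ 0 * f (Pi.single 0 1) + u₂ 1 * f (Pi.single 1 1) := by
    conv_lhs => rw [← (Pi.basisFun ℚ (Fin 2)).sum_repr u₂]
    simp [Fin.sum_univ_two]
  simp only [contract13, Fin.sum_univ_two, LinearMap.add_apply, LinearMap.comp_apply,
    LinearMap.applyₗ_apply_apply, rankOne_apply, map_smul, TensorProduct.map_tmul,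
    LinearMap.id_apply, LinearMap.proj_apply, LinearEquiv.coe_coe, TensorProduct.rid_tmul,
    ← TensorProduct.smul_tmul', hf]
  module

lemma contract13_brkt (D₁ D₂ : V2 →ₗ[ℚ] TT2) : contract13 (brkt D₁ D₂) = 0 := by
  induction D₁ using rankOne_tmul_induction with
  | hadd D D' h h' => rw [brkt_add_left, map_add, h, h', add_zero]
  | h f a b =>
    rw [brkt_swap, map_neg, neg_eq_zero]
    induction D₂ using rankOne_tmul_induction with
    | hadd D D' h h' => rw [brkt_add_left, map_add, h, h', add_zero]
    | h g c d =>
      simp only [brkt_rankOne, map_sub, map_add, map_smul, contract13_rankOne]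
      module

/-- The section `u ⊗ v ↦ e₀* ⊗ u ⊗ e₀ ⊗ v` of `contract13`. -/
noncomputable def contract13Section : TT2 →ₗ[ℚ] (V2 →ₗ[ℚ] TT3) :=
  dualTensorHom ℚ V2 TT3 ∘ₗ TensorProduct.mk ℚ _ _ (LinearMap.proj 0) ∘ₗ
    TensorProduct.map ((TensorProduct.mk ℚ V2 V2).flip (Pi.single 0 1)) LinearMap.id

lemma contract13Section_tmul (u v : V2) :
    contract13Section (u ⊗ₜ v) =
      rankOne (LinearMap.proj 0) ((u ⊗ₜ[ℚ] (Pi.single 0 1 : V2)) ⊗ₜ[ℚ] v) := by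
  simp [contract13Section]

lemma contract13_section (t : TT2) : contract13 (contract13Section t) = t := by
  induction t using TensorProduct.induction_on with
  | zero => simp
  | add x y hx hy => rw [map_add, map_add, hx, hy]
  | tmul u v => rw [contract13Section_tmul, contract13_rankOne]; simp

/-- The matrix units `e_i* ⊗ e_j ⊗ e_k ⊗ e_l` as a basis of `Hom(V, V^{⊗3})`. -/
noncomputable def homBasis :
    Module.Basis (Fin 2 × ((Fin 2 × Fin 2) × Fin 2)) ℚ (V2 →ₗ[ℚ] TT3) :=
  ((Pi.basisFun ℚ (Fin 2)).dualBasis.tensorProduct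
    (((Pi.basisFun ℚ (Fin 2)).tensorProduct (Pi.basisFun ℚ (Fin 2))).tensorProduct
      (Pi.basisFun ℚ (Fin 2)))).map (dualTensorHomEquiv ℚ V2 TT3)

lemma homBasis_apply (i j k l : Fin 2) :
    homBasis (i, (j, k), l) = rankOne (LinearMap.proj i)
      (((Pi.single j 1 : V2) ⊗ₜ[ℚ] (Pi.single k 1 : V2)) ⊗ₜ[ℚ] (Pi.single l 1 : V2)) := by
  have h : (Pi.basisFun ℚ (Fin 2)).dualBasis i = LinearMap.proj i := by
    ext; simp
  simp [homBasis, h]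

lemma contract13_homBasis (i j k l : Fin 2) :
    contract13 (homBasis (i, (j, k), l)) =
      if i = k then (Pi.single j 1 : V2) ⊗ₜ[ℚ] (Pi.single l 1 : V2) else 0 := by
  rw [homBasis_apply, contract13_rankOne]
  simp [Pi.single_apply]

/-- The span of all brackets `[D₁, D₂]`. -/
noncomputable abbrev brktSpan : Submodule ℚ (V2 →ₗ[ℚ] TT3) :=
  Submodule.span ℚ {E | ∃ D₁ D₂ : V2 →ₗ[ℚ] TT2, E = brkt D₁ D₂}

lemma homBasis_bracket_mem (f a b g c d : Fin 2) :
    (if f = c then homBasis (g, (a, b), d) else 0) + (if f = d then homBasis (g, (c, a), b) else 0)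
      - (if g = a then homBasis (f, (c, d), b) else 0)
      - (if g = b then homBasis (f, (a, c), d) else 0) ∈ brktSpan := by
  refine Submodule.subset_span ⟨rankOne (LinearMap.proj f) (Pi.single a 1 ⊗ₜ Pi.single b 1),
    rankOne (LinearMap.proj g) (Pi.single c 1 ⊗ₜ Pi.single d 1), ?_⟩
  rw [brkt_rankOne]
  simp only [homBasis_apply, LinearMap.proj_apply, Pi.single_apply, ite_smul, one_smul, zero_smul]

lemma homBasis_mem_of_ne (i j k l : Fin 2) (h : i ≠ k) : homBasis (i, (j, k), l) ∈ brktSpan := by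
  have h1 := homBasis_bracket_mem 0 0 0 0 0 1
  have h2 := homBasis_bracket_mem 0 0 1 1 1 1
  have h3 := homBasis_bracket_mem 0 1 0 1 1 1
  have h4 := homBasis_bracket_mem 0 0 1 0 1 1
  have h5 := homBasis_bracket_mem 1 0 0 1 0 1
  have h6 := homBasis_bracket_mem 0 0 0 1 0 1
  have h7 := homBasis_bracket_mem 0 0 0 1 1 0
  have h8 := homBasis_bracket_mem 1 0 1 1 1 1
  rw [← neg_mem_iff] at h1 h2 h3 h4
  fin_cases i <;> fin_cases k <;> first | exact absurd rfl h | skip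
  all_goals fin_cases j <;> fin_cases l
  all_goals simp at h1 h2 h3 h4 h5 h6 h7 h8 ⊢
  all_goals assumption

lemma homBasis_sub_mem (j l : Fin 2) :
    homBasis (1, (j, 1), l) - homBasis (0, (j, 0), l) ∈ brktSpan := by
  fin_cases j <;> fin_cases l
  · convert sub_mem (homBasis_bracket_mem 0 0 1 1 0 0) (homBasis_bracket_mem 0 0 0 1 0 1) using 1
    simp
    abel
  · simpa using homBasis_bracket_mem 0 0 1 1 0 1
  · simpa using homBasis_bracket_mem 0 1 0 1 1 0
  · convert sub_mem (homBasis_bracket_mem 0 1 1 1 0 1) (homBasis_bracket_mem 0 0 1 1 1 1) using 1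
    simp
    abel

lemma sub_section_mem (D : V2 →ₗ[ℚ] TT3) : D - contract13Section (contract13 D) ∈ brktSpan := by
  have h : brktSpan.mkQ ∘ₗ (LinearMap.id - contract13Section ∘ₗ contract13) = 0 := by
    refine homBasis.ext fun ⟨i, ⟨j, k⟩, l⟩ => ?_
    have hmem : homBasis (i, (j, k), l)
        - contract13Section (contract13 (homBasis (i, (j, k), l))) ∈ brktSpan := by
      rw [contract13_homBasis]
      split_ifs with hik
      · subst hik
        rw [contract13Section_tmul, ← homBasis_apply]
        fin_cases i
        · simp
        · exact homBasis_sub_mem j l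
      · simpa using homBasis_mem_of_ne i j k l hik
    simpa [Submodule.Quotient.mk_eq_zero] using (Submodule.Quotient.mk_eq_zero _).2 hmem
  have h' := LinearMap.congr_fun h D
  exact (Submodule.Quotient.mk_eq_zero _).1 h'

lemma ker_contract13 : LinearMap.ker contract13 = brktSpan := by
  apply le_antisymm
  · intro D hD
    simpa [LinearMap.mem_ker.1 hD] using sub_section_mem D
  · rw [Submodule.span_le]
    rintro _ ⟨D₁, D₂, rfl⟩
    exact contract13_brkt D₁ D₂

/-- for `V = ℚ²`, the kernel of the contraction
`C₁₃ : Hom(V, V^{⊗3}) → V^{⊗2}` equals the span of the brackets `[D₁, D₂]` with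
`D₁, D₂ : V → V^{⊗2}`; consequently `C₁₃` induces a linear isomorphism
`Hom(V,V^{⊗3})/span{[D₁,D₂]} ≅ V^{⊗2}`. -/
theorem stmt14 :
    ∃ C : (V2 →ₗ[ℚ] TT3) →ₗ[ℚ] TT2,
      (∀ (f : Module.Dual ℚ V2) (u₁ u₂ u₃ : V2),
        C (dualTensorHom ℚ V2 TT3 (f ⊗ₜ ((u₁ ⊗ₜ u₂) ⊗ₜ u₃))) = f u₂ • (u₁ ⊗ₜ u₃)) ∧
      LinearMap.ker C = Submodule.span ℚ {E | ∃ D₁ D₂ : V2 →ₗ[ℚ] TT2, E = brkt D₁ D₂} ∧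
      ∃ e : ((V2 →ₗ[ℚ] TT3) ⧸
            Submodule.span ℚ {E | ∃ D₁ D₂ : V2 →ₗ[ℚ] TT2, E = brkt D₁ D₂}) ≃ₗ[ℚ] TT2,
        ∀ D : V2 →ₗ[ℚ] TT3, e (Submodule.Quotient.mk D) = C D := by
  exact ⟨contract13, contract13_rankOne, ker_contract13,
    (Submodule.quotEquivOfEq _ _ ker_contract13.symm).trans
      (contract13.quotKerEquivOfSurjective fun t => ⟨_, contract13_section t⟩),
    fun D => rfl⟩
end

section
/- For V = ℚ², every linear map V → V^{⊗5} is a finite sum of brackets [D₁,D₂] with D₁ : V → V^{⊗2} and D₂ : V → V^{⊗4} linear; in particular the weight-4 part of the abelianization of Der⁺(T(V)) vanishes. -/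
abbrev TV (m : ℕ) := (Fin m → Fin 2) → ℚ

/-- The unique extension of `D : V → V^{⊗(k+1)}` to a derivation of the tensor algebra,
restricted to a map `V^{⊗m} → V^{⊗(m+k)}` (in coordinates): on decomposables it is
`u₁⊗⋯⊗u_m ↦ Σ_p u₁⊗⋯⊗D(u_p)⊗⋯⊗u_m`. -/
def ext (k m : ℕ) (D : V2 →ₗ[ℚ] TV (k+1)) : TV m →ₗ[ℚ] TV (m+k) where
  toFun t := fun ψ =>
    ∑ p : Fin m, ∑ c : Fin 2,
      D (Pi.single c 1) (fun r : Fin (k+1) => ψ ⟨p.1 + r.1, by have := p.2; have := r.2; omega⟩)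
        * t (fun q : Fin m =>
            if q.1 < p.1 then ψ ⟨q.1, by have := q.2; omega⟩
            else if q = p then c
            else ψ ⟨q.1 + k, by have := q.2; omega⟩)
  map_add' t t' := by
    funext ψ
    simp only [Pi.add_apply]
    rw [← Finset.sum_add_distrib]
    refine Finset.sum_congr rfl fun p _ => ?_
    rw [← Finset.sum_add_distrib]
    refine Finset.sum_congr rfl fun c _ => ?_
    ring
  map_smul' a t := by
    funext ψ
    simp only [Pi.smul_apply, smul_eq_mul, RingHom.id_apply]
    rw [Finset.mul_sum]
    refine Finset.sum_congr rfl fun p _ => ?_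
    rw [Finset.mul_sum]
    refine Finset.sum_congr rfl fun c _ => ?_
    ring

/-- the bracket `[D₁, D₂]` of `D₁ : V → V^{⊗2}` and `D₂ : V → V^{⊗4}`, i.e. the
restriction to `V` of `D̃₁ ∘ D̃₂ - D̃₂ ∘ D̃₁`. -/
def brkt13 (D₁ : V2 →ₗ[ℚ] TV 2) (D₂ : V2 →ₗ[ℚ] TV 4) : V2 →ₗ[ℚ] TV 5 :=
  (ext 1 4 D₁) ∘ₗ D₂ - (ext 3 2 D₂) ∘ₗ D₁

/-- The elementary map sending the basis vector `e_a` to the basis tensor `w` and the other basis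
vector to `0`. -/
def elemMap {m : ℕ} (a : Fin 2) (w : Fin m → Fin 2) : V2 →ₗ[ℚ] TV m :=
  (LinearMap.proj a).smulRight (Pi.single w 1)

theorem elemMap_single {m : ℕ} (a c : Fin 2) (w ψ : Fin m → Fin 2) :
    elemMap a w (Pi.single c 1) ψ = if c = a ∧ ψ = w then 1 else 0 := by
  simp only [elemMap, LinearMap.smulRight_apply, LinearMap.proj_apply, Pi.smul_apply,
    Pi.single_apply, smul_eq_mul, mul_ite, mul_one, mul_zero, ite_and]
  grind

theorem brkt13_elemMap (a b u₁ u₂ v₁ v₂ v₃ v₄ : Fin 2) :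
    brkt13 (elemMap a ![u₁, u₂]) (elemMap b ![v₁, v₂, v₃, v₄]) =
      (if v₁ = a then elemMap b ![u₁, u₂, v₂, v₃, v₄] else 0)
      + (if v₂ = a then elemMap b ![v₁, u₁, u₂, v₃, v₄] else 0)
      + (if v₃ = a then elemMap b ![v₁, v₂, u₁, u₂, v₄] else 0)
      + (if v₄ = a then elemMap b ![v₁, v₂, v₃, u₁, u₂] else 0)
      - ((if u₁ = b then elemMap a ![v₁, v₂, v₃, v₄, u₂] else 0)
      + (if u₂ = b then elemMap a ![u₁, v₁, v₂, v₃, v₄] else 0)) := by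
  have happ : ∀ (p : Prop) [Decidable p] (D : V2 →ₗ[ℚ] TV 5) (x : V2) (ψ : Fin 5 → Fin 2),
      (if p then D else 0) x ψ = if p then D x ψ else 0 := by
    intro p _ D x ψ; split_ifs <;> rfl
  refine LinearMap.pi_ext' fun c => LinearMap.ext_ring ?_
  funext ψ
  simp only [brkt13, ext, LinearMap.coe_comp, Function.comp_apply, LinearMap.coe_single,
    LinearMap.sub_apply, LinearMap.add_apply, Pi.sub_apply, Pi.add_apply, happ, LinearMap.coe_mk,
    AddHom.coe_mk, elemMap_single, Fin.sum_univ_four, Fin.sum_univ_two, funext_iff,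
    Fin.forall_fin_succ, ← ite_and, mul_ite, mul_one, mul_zero]
  simp
  refine congrArg₂ (· - ·) (congrArg₂ (· + ·) (congrArg₂ (· + ·) (congrArg₂ (· + ·) ?_ ?_) ?_) ?_)
    (congrArg₂ (· + ·) ?_ ?_)
  all_goals grind

theorem eq_zero_of_relations (X : Fin 2 → Fin 2 → Fin 2 → Fin 2 → Fin 2 → Fin 2 → ℚ)
    (h : ∀ a b u₁ u₂ v₁ v₂ v₃ v₄ : Fin 2,
      (if v₁ = a then X b u₁ u₂ v₂ v₃ v₄ else 0)
      + (if v₂ = a then X b v₁ u₁ u₂ v₃ v₄ else 0)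
      + (if v₃ = a then X b v₁ v₂ u₁ u₂ v₄ else 0)
      + (if v₄ = a then X b v₁ v₂ v₃ u₁ u₂ else 0)
      = (if u₁ = b then X a v₁ v₂ v₃ v₄ u₂ else 0)
      + (if u₂ = b then X a u₁ v₁ v₂ v₃ v₄ else 0)) :
    ∀ a v₁ v₂ v₃ v₄ v₅, X a v₁ v₂ v₃ v₄ v₅ = 0 := by
  simp [Fin.forall_fin_two] at h ⊢
  grind

theorem ext_smul (k m : ℕ) (c : ℚ) (D : V2 →ₗ[ℚ] TV (k + 1)) :
    ext k m (c • D) = c • ext k m D := by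
  refine LinearMap.ext fun t => funext fun ψ => ?_
  simp [ext, Finset.mul_sum, mul_assoc, mul_add]

theorem brkt13_smul_left (c : ℚ) (D₁ : V2 →ₗ[ℚ] TV 2) (D₂ : V2 →ₗ[ℚ] TV 4) :
    brkt13 (c • D₁) D₂ = c • brkt13 D₁ D₂ := by
  simp only [brkt13, ext_smul, LinearMap.smul_comp, LinearMap.comp_smul, smul_sub]

theorem dual_eq_zero_of_elemMap {m : ℕ} (f : (V2 →ₗ[ℚ] TV m) →ₗ[ℚ] ℚ)
    (hf : ∀ a w, f (elemMap a w) = 0) : f = 0 := by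
  refine LinearMap.ext fun D => ?_
  have hD : D = ∑ a, ∑ w, D (Pi.single a 1) w • elemMap a w := by
    refine LinearMap.pi_ext' fun c => LinearMap.ext_ring ?_
    funext ψ
    fin_cases c <;> simp [elemMap_single]
  rw [hD]
  simp [hf]

theorem span_range_brkt13 :
    Submodule.span ℚ (Set.range fun p : (V2 →ₗ[ℚ] TV 2) × (V2 →ₗ[ℚ] TV 4) =>
      brkt13 p.1 p.2) = ⊤ := by
  by_contra hne
  obtain ⟨f, hf0, hf⟩ := Submodule.exists_le_ker_of_lt_top _ (lt_top_iff_ne_top.2 hne)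
  have hbr : ∀ D₁ D₂, f (brkt13 D₁ D₂) = 0 := fun D₁ D₂ =>
    hf (Submodule.subset_span ⟨(D₁, D₂), rfl⟩)
  have hX := eq_zero_of_relations (fun a v₁ v₂ v₃ v₄ v₅ => f (elemMap a ![v₁, v₂, v₃, v₄, v₅]))
    fun a b u₁ u₂ v₁ v₂ v₃ v₄ => by
      have := hbr (elemMap a ![u₁, u₂]) (elemMap b ![v₁, v₂, v₃, v₄])
      rw [brkt13_elemMap, map_sub, sub_eq_zero] at this
      simpa only [map_add, apply_ite f, map_zero] using this
  refine hf0 (dual_eq_zero_of_elemMap f fun a w => ?_)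
  have hw : w = ![w 0, w 1, w 2, w 3, w 4] := by
    funext i; fin_cases i <;> rfl
  rw [hw]
  exact hX a _ _ _ _ _

/-- for `V = ℚ²`, every linear map `V → V^{⊗5}` is a finite sum of brackets
`[D₁,D₂]` with `D₁ : V → V^{⊗2}` and `D₂ : V → V^{⊗4}`; in particular the weight 4 part of
the abelianization of `Der⁺(T(V))` vanishes. -/
theorem stmt16 (E : V2 →ₗ[ℚ] TV 5) :
    ∃ (n : ℕ) (D₁ : Fin n → (V2 →ₗ[ℚ] TV 2)) (D₂ : Fin n → (V2 →ₗ[ℚ] TV 4)),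
      E = ∑ i : Fin n, brkt13 (D₁ i) (D₂ i) := by
  have hE := span_range_brkt13.ge (Submodule.mem_top (x := E))
  obtain ⟨n, c, g, hg⟩ := Submodule.mem_span_set'.1 hE
  choose p hp using fun i => (g i).2
  refine ⟨n, fun i => c i • (p i).1, fun i => (p i).2, ?_⟩
  rw [← hg]
  exact Finset.sum_congr rfl fun i _ => by rw [brkt13_smul_left, ← hp i]
end
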